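/- (Guarantee for maximum mean absolute deviation rounding.) Let X be a nonzero real n×p matrix and let R be a real n×m matrix each of whose rows has unit Euclidean norm, such that Z⋆ = R Rᵀ maximizes trace(X Xᵀ Z) over all real symmetric positive-semidefinite n×n matrices Z with unit diagonal; set α⋆ = √(trace(R Rᵀ X Xᵀ)). Let g⁽¹⁾, …, g⁽ᴷ⁾ be independent standard Gaussian random vectors in ℝ^m; for each k set y⁽ᵏ⁾ = sign(R g⁽ᵏ⁾) and v⁽ᵏ⁾ = Xᵀ y⁽ᵏ⁾ / ‖Xᵀ y⁽ᵏ⁾‖₂ (with v⁽ᵏ⁾ = 0 if Xᵀ y⁽ᵏ⁾ = 0), and let v⋆ be a vector among v⁽¹⁾, …, v⁽ᴷ⁾ maximizing ‖X v⁽ᵏ⁾‖₁. Then α⋆ ≥ ‖X‖_{2→1}, and for every θ ∈ [0,1], the inequality ‖X v⋆‖₁ > θ √(2/π) α⋆ holds except with probability at most e^{−2K(1−θ²)/π}. -/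

import Mathlib

open Matrix MeasureTheory
open scoped BigOperators

/-- The ℓ1 norm of a vector: sum of absolute values of the entries. -/
def l1norm {n : ℕ} (v : Fin n → ℝ) : ℝ := ∑ i, |v i|

/-- The Euclidean (ℓ2) norm of a vector. -/
noncomputable def l2norm {p : ℕ} (u : Fin p → ℝ) : ℝ := Real.sqrt (∑ j, u j ^ 2)

/-- The ℓ2 → ℓ1 operator norm of a matrix. -/
noncomputable def norm2to1 {n p : ℕ} (X : Matrix (Fin n) (Fin p) ℝ) : ℝ :=
  sSup {t : ℝ | ∃ u : Fin p → ℝ, l2norm u ≤ 1 ∧ t = l1norm (X.mulVec u)}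

/-- The sign of a real number: `1` if `0 ≤ t` and `-1` otherwise. -/
noncomputable def sgn (t : ℝ) : ℝ := if 0 ≤ t then 1 else -1

/-- The joint law of `K` independent standard Gaussian random vectors in ℝ^m. -/
noncomputable def stdGaussianSeq (K m : ℕ) : Measure (Fin K → Fin m → ℝ) :=
  Measure.pi fun _ : Fin K => Measure.pi fun _ : Fin m => ProbabilityTheory.gaussianReal 0 1

/-- The standard Gaussian measure on `Fin m → ℝ`. -/
noncomputable def stdGaussianPi (m : ℕ) : Measure (Fin m → ℝ) :=
  Measure.pi fun _ : Fin m => ProbabilityTheory.gaussianReal 0 1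

namespace stdGaussianPi

open ProbabilityTheory

variable {m : ℕ}

instance : IsProbabilityMeasure (stdGaussianPi m) := by
  unfold stdGaussianPi; infer_instance

lemma map_eval (i : Fin m) : (stdGaussianPi m).map (fun g => g i) = gaussianReal 0 1 :=
  (measurePreserving_eval (fun _ : Fin m => gaussianReal 0 1) i).map_eq

lemma iIndepFun_eval : iIndepFun (fun (i : Fin m) (g : Fin m → ℝ) => g i) (stdGaussianPi m) :=
  iIndepFun_pi (X := fun _ => id) (fun _ => aemeasurable_id)

lemma hasGaussianLaw_eval (i : Fin m) :
    HasGaussianLaw (fun g : Fin m → ℝ => g i) (stdGaussianPi m) where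
  isGaussian_map := by rw [map_eval]; infer_instance

lemma hasGaussianLaw_id : HasGaussianLaw (fun g : Fin m → ℝ => g) (stdGaussianPi m) :=
  iIndepFun_eval.hasGaussianLaw hasGaussianLaw_eval

lemma hasGaussianLaw_dotProduct_prod (a b : Fin m → ℝ) :
    HasGaussianLaw (fun g : Fin m → ℝ => (a ⬝ᵥ g, b ⬝ᵥ g)) (stdGaussianPi m) :=
  hasGaussianLaw_id.map_fun
    (((dotProductBilin ℝ ℝ a).prod (dotProductBilin ℝ ℝ b)).toContinuousLinearMap)

lemma hasGaussianLaw_dotProduct (a : Fin m → ℝ) :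
    HasGaussianLaw (fun g : Fin m → ℝ => a ⬝ᵥ g) (stdGaussianPi m) :=
  (hasGaussianLaw_dotProduct_prod a a).fst

lemma integral_dotProduct (a : Fin m → ℝ) : ∫ g, a ⬝ᵥ g ∂stdGaussianPi m = 0 := by
  have hi (i : Fin m) : ∫ g, g i ∂stdGaussianPi m = 0 := by
    have h := integral_id_gaussianReal (μ := 0) (v := 1)
    rw [← map_eval i, integral_map (hasGaussianLaw_eval i).aemeasurable (by fun_prop)] at h
    exact h
  simp_rw [dotProduct]
  rw [integral_finsetSum _ fun i _ => (hasGaussianLaw_eval i).integrable.const_mul _]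
  simp [integral_const_mul, hi]

lemma covariance_dotProduct (a b : Fin m → ℝ) :
    cov[fun g => a ⬝ᵥ g, fun g => b ⬝ᵥ g; stdGaussianPi m] = a ⬝ᵥ b := by
  have hij (i j : Fin m) :
      cov[fun g : Fin m → ℝ => g i, fun g => g j; stdGaussianPi m] = if i = j then 1 else 0 := by
    split_ifs with h
    · subst h
      rw [covariance_self (hasGaussianLaw_eval i).aemeasurable]
      have h := variance_id_gaussianReal (μ := 0) (v := 1)
      rw [← map_eval i, variance_map (by fun_prop) (hasGaussianLaw_eval i).aemeasurable] at h
      simpa using h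
    · exact (iIndepFun_eval.indepFun h).covariance_eq_zero (hasGaussianLaw_eval i).memLp_two
        (hasGaussianLaw_eval j).memLp_two
  simp_rw [dotProduct]
  rw [covariance_fun_sum_fun_sum (fun i => (hasGaussianLaw_eval i).memLp_two.const_mul _)
    (fun i => (hasGaussianLaw_eval i).memLp_two.const_mul _)]
  simp [covariance_const_mul_left, covariance_const_mul_right, hij, mul_comm]

lemma integral_dotProduct_mul_dotProduct (a b : Fin m → ℝ) :
    ∫ g, (a ⬝ᵥ g) * (b ⬝ᵥ g) ∂stdGaussianPi m = a ⬝ᵥ b := by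
  rw [← covariance_dotProduct, covariance, integral_dotProduct, integral_dotProduct]
  simp

lemma map_dotProduct {a : Fin m → ℝ} (ha : a ⬝ᵥ a = 1) :
    (stdGaussianPi m).map (fun g => a ⬝ᵥ g) = gaussianReal 0 1 := by
  rw [(hasGaussianLaw_dotProduct a).map_eq_gaussianReal, integral_dotProduct,
    ← covariance_self (hasGaussianLaw_dotProduct a).aemeasurable, covariance_dotProduct, ha]
  simp

end stdGaussianPi

lemma integral_abs_gaussianReal :
    ∫ x, |x| ∂ProbabilityTheory.gaussianReal 0 1 = √(2 / Real.pi) := by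
  rw [ProbabilityTheory.integral_gaussianReal_eq_integral_smul one_ne_zero]
  have h := integral_comp_abs
    (f := fun x => ProbabilityTheory.gaussianPDFReal 0 1 x * x)
  have h2 := integral_rpow_mul_exp_neg_mul_rpow (p := 2) (q := 1) (b := 1 / 2) two_pos
    (by norm_num) (by norm_num)
  have e (x : ℝ) : ProbabilityTheory.gaussianPDFReal 0 1 x • |x| =
      ProbabilityTheory.gaussianPDFReal 0 1 |x| * |x| := by
    simp [ProbabilityTheory.gaussianPDFReal]
  have e2 (x : ℝ) : ProbabilityTheory.gaussianPDFReal 0 1 x * x =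
      (√(2 * Real.pi))⁻¹ * (x ^ (1 : ℝ) * Real.exp (-(1 / 2) * x ^ (2 : ℝ))) := by
    simp only [ProbabilityTheory.gaussianPDFReal, Real.rpow_one, Real.rpow_two]
    rw [show -(x - 0) ^ 2 / (2 * ((1 : NNReal) : ℝ)) = -(1 / 2) * x ^ 2 by simp; ring]
    simp; ring
  simp_rw [e]
  rw [h]
  simp_rw [e2]
  rw [integral_const_mul, h2]
  norm_num
  have : √Real.pi ≠ 0 := by positivity
  field_simp
  norm_num

lemma measurable_sgn : Measurable sgn :=
  Measurable.ite measurableSet_Ici measurable_const measurable_const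

lemma sgn_mul_self (t : ℝ) : sgn t * t = |t| := by
  unfold sgn
  split_ifs with h
  · rw [one_mul, abs_of_nonneg h]
  · rw [abs_of_neg (not_le.1 h), neg_one_mul]

lemma abs_sgn (t : ℝ) : |sgn t| = 1 := by
  unfold sgn; split_ifs <;> simp

lemma integral_sgn_dotProduct_mul_dotProduct {m : ℕ} {a : Fin m → ℝ} (ha : a ⬝ᵥ a = 1)
    (b : Fin m → ℝ) :
    ∫ g, sgn (a ⬝ᵥ g) * (b ⬝ᵥ g) ∂stdGaussianPi m = √(2 / Real.pi) * (a ⬝ᵥ b) := by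
  set c := b - (a ⬝ᵥ b) • a with hc
  have hac : a ⬝ᵥ c = 0 := by simp [hc, dotProduct_sub, ha]
  have hmeas : Measurable fun g : Fin m → ℝ => sgn (a ⬝ᵥ g) :=
    measurable_sgn.comp (by unfold dotProduct; fun_prop)
  have hbd : ∀ᵐ g ∂stdGaussianPi m, ‖sgn (a ⬝ᵥ g)‖ ≤ 1 :=
    Filter.Eventually.of_forall fun g => (abs_sgn _).le
  have hind : ∫ g, sgn (a ⬝ᵥ g) * (c ⬝ᵥ g) ∂stdGaussianPi m = 0 := by
    have h := (stdGaussianPi.hasGaussianLaw_dotProduct_prod a c).indepFun_of_covariance_eq_zero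
      (by rw [stdGaussianPi.covariance_dotProduct, hac])
    refine (h.integral_fun_comp_mul_comp (f := sgn) (g := id)
      (stdGaussianPi.hasGaussianLaw_dotProduct a).aemeasurable
      (stdGaussianPi.hasGaussianLaw_dotProduct c).aemeasurable
      measurable_sgn.aestronglyMeasurable (by fun_prop)).trans ?_
    simp [stdGaussianPi.integral_dotProduct]
  have habs : ∫ g, |a ⬝ᵥ g| ∂stdGaussianPi m = √(2 / Real.pi) := by
    rw [← integral_abs_gaussianReal, ← stdGaussianPi.map_dotProduct ha,
      integral_map (stdGaussianPi.hasGaussianLaw_dotProduct a).aemeasurable (by fun_prop)]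
  have hsplit (g : Fin m → ℝ) :
      sgn (a ⬝ᵥ g) * (b ⬝ᵥ g) = (a ⬝ᵥ b) * |a ⬝ᵥ g| + sgn (a ⬝ᵥ g) * (c ⬝ᵥ g) := by
    rw [← sgn_mul_self, hc, sub_dotProduct, smul_dotProduct, smul_eq_mul]; ring
  simp_rw [hsplit]
  rw [integral_add ((stdGaussianPi.hasGaussianLaw_dotProduct a).integrable.abs.const_mul _)
    ((stdGaussianPi.hasGaussianLaw_dotProduct c).integrable.bdd_mul
      hmeas.aestronglyMeasurable hbd), hind, integral_const_mul, habs]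
  ring

lemma measurable_sgn_mulVec {n m : ℕ} (R : Matrix (Fin n) (Fin m) ℝ) (i : Fin n) :
    Measurable fun g : Fin m → ℝ => sgn ((R *ᵥ g) i) :=
  measurable_sgn.comp (by unfold mulVec dotProduct; fun_prop)

lemma measurable_dotProduct_sgn_mulVec {n m : ℕ} (R : Matrix (Fin n) (Fin m) ℝ)
    (x : Fin n → ℝ) : Measurable fun g : Fin m → ℝ => x ⬝ᵥ fun i => sgn ((R *ᵥ g) i) :=
  Finset.measurable_sum _ fun i _ => (measurable_sgn_mulVec R i).const_mul _

lemma abs_dotProduct_sgn_le {n : ℕ} (x t : Fin n → ℝ) :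
    |x ⬝ᵥ fun i => sgn (t i)| ≤ ∑ i, |x i| := by
  refine (Finset.abs_sum_le_sum_abs _ _).trans (Finset.sum_le_sum fun i _ => ?_)
  rw [abs_mul, abs_sgn, mul_one]

lemma integrable_sq_dotProduct_sgn_mulVec {n m : ℕ} (R : Matrix (Fin n) (Fin m) ℝ)
    (x : Fin n → ℝ) :
    Integrable (fun g => (x ⬝ᵥ fun i => sgn ((R *ᵥ g) i)) ^ 2) (stdGaussianPi m) := by
  refine Integrable.of_bound
    ((measurable_dotProduct_sgn_mulVec R x).pow_const 2).aestronglyMeasurable ((∑ i, |x i|) ^ 2)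
    (Filter.Eventually.of_forall fun g => ?_)
  rw [norm_pow]
  exact pow_le_pow_left₀ (norm_nonneg _) (abs_dotProduct_sgn_le x _) 2

/-- Rietz's inequality for a rank-one positive semidefinite form: rounding the unit vectors `R i`
with a Gaussian hyperplane loses at most a factor `2 / π`. -/
lemma integral_sq_dotProduct_sgn_mulVec_ge {n m : ℕ} {R : Matrix (Fin n) (Fin m) ℝ}
    (hR : ∀ i, R i ⬝ᵥ R i = 1) (x : Fin n → ℝ) :
    2 / Real.pi * ((x ᵥ* R) ⬝ᵥ (x ᵥ* R)) ≤
      ∫ g, (x ⬝ᵥ fun i => sgn ((R *ᵥ g) i)) ^ 2 ∂stdGaussianPi m := by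
  set b := x ᵥ* R with hb
  set κ := √(2 / Real.pi) with hκ
  have hκ2 : κ ^ 2 = 2 / Real.pi := Real.sq_sqrt (by positivity)
  set w : (Fin m → ℝ) → ℝ := fun g => x ⬝ᵥ fun i => sgn ((R *ᵥ g) i) with hw
  have hwm : Measurable w := measurable_dotProduct_sgn_mulVec R x
  have hwb (g) : ‖w g‖ ≤ ∑ i, |x i| := abs_dotProduct_sgn_le x _
  have hgauss := stdGaussianPi.hasGaussianLaw_dotProduct b
  have hw2 : Integrable (fun g => w g ^ 2) (stdGaussianPi m) :=
    integrable_sq_dotProduct_sgn_mulVec R x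
  have hwv : Integrable (fun g => w g * (b ⬝ᵥ g)) (stdGaussianPi m) :=
    hgauss.integrable.bdd_mul hwm.aestronglyMeasurable (Filter.Eventually.of_forall hwb)
  have hv2 : Integrable (fun g => (b ⬝ᵥ g) * (b ⬝ᵥ g)) (stdGaussianPi m) :=
    hgauss.memLp_two.integrable_mul hgauss.memLp_two
  have hwv_eq : ∫ g, w g * (b ⬝ᵥ g) ∂stdGaussianPi m = κ * (b ⬝ᵥ b) := by
    have h1 (g : Fin m → ℝ) :
        w g * (b ⬝ᵥ g) = ∑ i, x i * (sgn (R i ⬝ᵥ g) * (b ⬝ᵥ g)) := by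
      simp only [hw, dotProduct, mulVec, Finset.sum_mul, mul_assoc]
    simp_rw [h1]
    rw [integral_finsetSum]
    · simp_rw [integral_const_mul, integral_sgn_dotProduct_mul_dotProduct (hR _)]
      rw [hb, ← dotProduct_mulVec, ← hb, dotProduct, Finset.mul_sum]
      refine Finset.sum_congr rfl fun i _ => ?_
      simp only [mulVec]; ring
    · exact fun i _ => (hgauss.integrable.bdd_mul (measurable_sgn_mulVec R i).aestronglyMeasurable
        (Filter.Eventually.of_forall fun g => (abs_sgn _).le)).const_mul _
  have hnonneg : 0 ≤ ∫ g, (w g ^ 2 - 2 * κ * (w g * (b ⬝ᵥ g)) + κ ^ 2 * ((b ⬝ᵥ g) * (b ⬝ᵥ g)))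
      ∂stdGaussianPi m := by
    refine integral_nonneg fun g => ?_
    simp only [Pi.zero_apply]
    nlinarith [sq_nonneg (w g - κ * (b ⬝ᵥ g))]
  rw [integral_add (f := fun g => w g ^ 2 - 2 * κ * (w g * (b ⬝ᵥ g)))
      (hw2.sub (hwv.const_mul _)) (hv2.const_mul _),
    integral_sub hw2 (hwv.const_mul _), integral_const_mul, integral_const_mul, hwv_eq,
    stdGaussianPi.integral_dotProduct_mul_dotProduct] at hnonneg
  rw [← hκ2]
  linarith

lemma l2norm_sq {p : ℕ} (u : Fin p → ℝ) : l2norm u ^ 2 = u ⬝ᵥ u := by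
  rw [l2norm, Real.sq_sqrt (Finset.sum_nonneg fun _ _ => sq_nonneg _)]
  simp [dotProduct, sq]

lemma l2norm_mulVec_sq {n p : ℕ} (A : Matrix (Fin p) (Fin n) ℝ) (s : Fin n → ℝ) :
    l2norm (A *ᵥ s) ^ 2 = ∑ k, (A k ⬝ᵥ s) ^ 2 := by
  rw [l2norm_sq]
  simp only [sq]
  rfl

lemma l2norm_nonneg {p : ℕ} (u : Fin p → ℝ) : 0 ≤ l2norm u := Real.sqrt_nonneg _

lemma dotProduct_le_l2norm_mul {p : ℕ} (u w : Fin p → ℝ) : u ⬝ᵥ w ≤ l2norm u * l2norm w :=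
  Real.sum_mul_le_sqrt_mul_sqrt _ _ _

lemma l1norm_nonneg {n : ℕ} (x : Fin n → ℝ) : 0 ≤ l1norm x :=
  Finset.sum_nonneg fun _ _ => abs_nonneg _

lemma l1norm_eq_sgn_dotProduct {n : ℕ} (x : Fin n → ℝ) :
    l1norm x = (fun i => sgn (x i)) ⬝ᵥ x := by
  simp [l1norm, dotProduct, sgn_mul_self]

lemma dotProduct_sgn_le_l1norm {n : ℕ} (t x : Fin n → ℝ) :
    (fun i => sgn (t i)) ⬝ᵥ x ≤ l1norm x :=
  Finset.sum_le_sum fun i _ => (le_abs_self _).trans (by rw [abs_mul, abs_sgn, one_mul])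

lemma trace_mul_vecMulVec_self {n p : ℕ} (X : Matrix (Fin n) (Fin p) ℝ) (s : Fin n → ℝ) :
    (X * Xᵀ * vecMulVec s s).trace = l2norm (Xᵀ *ᵥ s) ^ 2 := by
  rw [l2norm_sq, mul_vecMulVec, trace_vecMulVec, ← mulVec_mulVec, dotProduct_comm,
    dotProduct_mulVec, ← mulVec_transpose]

lemma sq_l2norm_mulVec_sgn_le {n p : ℕ} {X : Matrix (Fin n) (Fin p) ℝ} {a : ℝ}
    (ha : ∀ Z : Matrix (Fin n) (Fin n) ℝ, Z.PosSemidef → (∀ i, Z i i = 1) →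
      (X * Xᵀ * Z).trace ≤ a) (t : Fin n → ℝ) :
    l2norm (Xᵀ *ᵥ fun i => sgn (t i)) ^ 2 ≤ a := by
  rw [← trace_mul_vecMulVec_self]
  refine ha _ ?_ fun i => ?_
  · simpa using posSemidef_vecMulVec_self_star fun i => sgn (t i)
  · rw [vecMulVec_apply, ← abs_mul_abs_self, abs_sgn, one_mul]

/-- The semidefinite relaxation bounds the squared operator norm from above. -/
lemma norm2to1_le_sqrt {n p : ℕ} {X : Matrix (Fin n) (Fin p) ℝ} {a : ℝ}
    (ha : ∀ Z : Matrix (Fin n) (Fin n) ℝ, Z.PosSemidef → (∀ i, Z i i = 1) →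
      (X * Xᵀ * Z).trace ≤ a) :
    norm2to1 X ≤ √a := by
  refine csSup_le ⟨_, 0, by simp [l2norm], rfl⟩ ?_
  rintro _ ⟨u, hu, rfl⟩
  rw [l1norm_eq_sgn_dotProduct, dotProduct_mulVec, ← mulVec_transpose]
  refine (dotProduct_le_l2norm_mul _ _).trans ?_
  refine (mul_le_of_le_one_right (l2norm_nonneg _) hu).trans ?_
  exact Real.le_sqrt_of_sq_le (sq_l2norm_mulVec_sgn_le ha _)

lemma l2norm_mulVec_sgn_le_l1norm {n p : ℕ} (X : Matrix (Fin n) (Fin p) ℝ) (t : Fin n → ℝ) :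
    l2norm (Xᵀ *ᵥ fun i => sgn (t i)) ≤ l1norm (X *ᵥ
      ((l2norm (Xᵀ *ᵥ fun i => sgn (t i)))⁻¹ • Xᵀ *ᵥ fun i => sgn (t i))) := by
  set s : Fin n → ℝ := fun i => sgn (t i) with hs
  rcases (l2norm_nonneg (Xᵀ *ᵥ s)).eq_or_lt' with h | h
  · rw [h]; exact l1norm_nonneg _
  · refine le_of_eq_of_le ?_ (dotProduct_sgn_le_l1norm t _)
    rw [dotProduct_mulVec, ← mulVec_transpose, dotProduct_smul, smul_eq_mul, ← hs, ← l2norm_sq]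
    field_simp

lemma trace_mul_transpose_pos {n p : ℕ} {X : Matrix (Fin n) (Fin p) ℝ} (hX : X ≠ 0) :
    0 < (X * Xᵀ).trace := by
  have h := (posSemidef_self_mul_conjTranspose X).trace_nonneg
  rw [conjTranspose_eq_transpose_of_trivial] at h
  refine h.lt_of_ne' fun h0 => hX ?_
  rwa [← conjTranspose_eq_transpose_of_trivial, trace_mul_conjTranspose_self_eq_zero_iff] at h0

lemma integral_sq_l2norm_mulVec_sgn_ge {n p m : ℕ} (X : Matrix (Fin n) (Fin p) ℝ)
    {R : Matrix (Fin n) (Fin m) ℝ} (hR : ∀ i, R i ⬝ᵥ R i = 1) :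
    2 / Real.pi * (X * Xᵀ * (R * Rᵀ)).trace ≤
      ∫ g, l2norm (Xᵀ *ᵥ fun i => sgn ((R *ᵥ g) i)) ^ 2 ∂stdGaussianPi m := by
  have htr : (X * Xᵀ * (R * Rᵀ)).trace = ∑ k, ((Xᵀ k ᵥ* R) ⬝ᵥ (Xᵀ k ᵥ* R)) := by
    rw [show X * Xᵀ * (R * Rᵀ) = X * (Xᵀ * R * Rᵀ) by simp only [Matrix.mul_assoc],
      trace_mul_comm, Matrix.mul_assoc,
      show Rᵀ * X = (Xᵀ * R)ᵀ by rw [transpose_mul, transpose_transpose]]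
    rfl
  simp_rw [l2norm_mulVec_sq]
  rw [integral_finsetSum, htr, Finset.mul_sum]
  · exact Finset.sum_le_sum fun k _ => integral_sq_dotProduct_sgn_mulVec_ge hR (Xᵀ k)
  · exact fun k _ => integrable_sq_dotProduct_sgn_mulVec R (Xᵀ k)

/-- A reverse Markov inequality: a variable in `[0, a]` with mean at least `c * a` is at most
`t * c * a` with probability at most `exp (-c * (1 - t))`. -/
lemma measureReal_le_exp_of_le_integral {Ω : Type*} [MeasurableSpace Ω] {μ : Measure Ω}
    [IsProbabilityMeasure μ] {f : Ω → ℝ} (hf : Measurable f) {a c t : ℝ} (ha : 0 < a)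
    (h0 : ∀ ω, 0 ≤ f ω) (hfa : ∀ ω, f ω ≤ a) (hc0 : 0 ≤ c) (hc : c * a ≤ ∫ ω, f ω ∂μ)
    (ht0 : 0 ≤ t) :
    μ.real {ω | f ω ≤ t * c * a} ≤ Real.exp (-(c * (1 - t))) := by
  set S := {ω | f ω ≤ t * c * a} with hS
  have hSm : MeasurableSet S := measurableSet_le hf measurable_const
  have hfi : Integrable f μ := Integrable.of_bound hf.aestronglyMeasurable a
    (Filter.Eventually.of_forall fun ω => by
      rw [Real.norm_eq_abs, abs_of_nonneg (h0 ω)]; exact hfa ω)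
  have hle : ∫ ω, f ω ∂μ ≤ ∫ ω, (a - S.indicator (fun _ => a - t * c * a) ω) ∂μ := by
    refine integral_mono hfi ((integrable_const _).sub ((integrable_const _).indicator hSm))
      fun ω => ?_
    by_cases h : ω ∈ S
    · simpa [h] using (show f ω ≤ t * c * a from h)
    · simpa [h] using hfa ω
  rw [integral_sub (integrable_const _) ((integrable_const _).indicator hSm),
    integral_indicator_const _ hSm] at hle
  simp only [integral_const, probReal_univ, smul_eq_mul] at hle
  have hq0 : 0 ≤ μ.real S := measureReal_nonneg
  have hq1 : μ.real S ≤ 1 := measureReal_le_one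
  have hkey : c ≤ 1 - μ.real S * (1 - t * c) := by
    refine le_of_mul_le_mul_right ?_ ha
    linarith
  have hlin : μ.real S ≤ 1 - c * (1 - t) := by
    nlinarith [mul_nonneg (mul_nonneg ht0 hc0) (sub_nonneg.2 hq1)]
  linarith [Real.add_one_le_exp (-(c * (1 - t)))]

theorem mdr_guarantee {n p m K : ℕ} (hK : 0 < K)
    (X : Matrix (Fin n) (Fin p) ℝ) (hX : X ≠ 0)
    (R : Matrix (Fin n) (Fin m) ℝ)
    (hrows : ∀ i, ∑ j, R i j ^ 2 = 1)
    (hmax : ∀ Z : Matrix (Fin n) (Fin n) ℝ, Z.PosSemidef → (∀ i, Z i i = 1) →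
      (X * Xᵀ * Z).trace ≤ (X * Xᵀ * (R * Rᵀ)).trace)
    (αstar : ℝ) (hα : αstar = Real.sqrt (R * Rᵀ * (X * Xᵀ)).trace)
    (y : (Fin m → ℝ) → Fin n → ℝ)
    (hy : ∀ g, y g = fun i => sgn (R.mulVec g i))
    (v : (Fin m → ℝ) → Fin p → ℝ)
    (hv : ∀ g, v g = (l2norm (Xᵀ.mulVec (y g)))⁻¹ • Xᵀ.mulVec (y g))
    (vstar : (Fin K → Fin m → ℝ) → Fin p → ℝ)
    (hvstar : ∀ ω, (∃ k, vstar ω = v (ω k)) ∧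
      ∀ k, l1norm (X.mulVec (v (ω k))) ≤ l1norm (X.mulVec (vstar ω)))
    (θ : ℝ) (hθ : θ ∈ Set.Icc (0 : ℝ) 1) :
    norm2to1 X ≤ αstar ∧
      (stdGaussianSeq K m)
          {ω | ¬ θ * Real.sqrt (2 / Real.pi) * αstar < l1norm (X.mulVec (vstar ω))} ≤
        ENNReal.ofReal (Real.exp (-(2 * K * (1 - θ ^ 2)) / Real.pi)) := by
  have hRR : ∀ i, R i ⬝ᵥ R i = 1 := fun i => by simpa [dotProduct, sq] using hrows i
  set a := (X * Xᵀ * (R * Rᵀ)).trace with ha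
  have hαa : αstar = √a := by rw [hα, ha, trace_mul_comm]
  refine ⟨hαa ▸ norm2to1_le_sqrt hmax, ?_⟩
  have hpos : 0 < a := (trace_mul_transpose_pos hX).trans_le <| by
    simpa using hmax 1 PosSemidef.one fun i => one_apply_eq i
  set f : (Fin m → ℝ) → ℝ := fun g => l2norm (Xᵀ *ᵥ fun i => sgn ((R *ᵥ g) i)) ^ 2 with hf
  have hfm : Measurable f := by
    simp only [hf, l2norm_mulVec_sq]
    exact Finset.measurable_sum _ fun k _ =>
      (measurable_dotProduct_sgn_mulVec R (Xᵀ k)).pow_const 2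
  have hprob := measureReal_le_exp_of_le_integral (μ := stdGaussianPi m) hfm hpos
    (fun g => sq_nonneg _) (fun g => sq_l2norm_mulVec_sgn_le hmax _) (by positivity)
    (integral_sq_l2norm_mulVec_sgn_ge X hRR) (sq_nonneg θ)
  set S := {g | f g ≤ θ ^ 2 * (2 / Real.pi) * a} with hS
  have hsub : {ω | ¬ θ * √(2 / Real.pi) * αstar < l1norm (X *ᵥ vstar ω)} ⊆
      Set.univ.pi fun _ : Fin K => S := by
    intro ω hω k _
    have h1 : l2norm (Xᵀ *ᵥ fun i => sgn ((R *ᵥ ω k) i)) ≤ θ * √(2 / Real.pi) * αstar := by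
      refine (l2norm_mulVec_sgn_le_l1norm X (R *ᵥ ω k)).trans ?_
      have h := (hvstar ω).2 k
      rw [hv, hy] at h
      exact h.trans (not_lt.1 hω)
    have h2 := pow_le_pow_left₀ (l2norm_nonneg _) h1 2
    rwa [mul_pow, mul_pow, hαa, Real.sq_sqrt (by positivity), Real.sq_sqrt hpos.le] at h2
  calc stdGaussianSeq K m _ ≤ stdGaussianSeq K m (Set.univ.pi fun _ : Fin K => S) :=
        measure_mono hsub
    _ = stdGaussianPi m S ^ K := by
        change Measure.pi (fun _ : Fin K => stdGaussianPi m) _ = _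
        rw [Measure.pi_pi, Finset.prod_const, Finset.card_univ, Fintype.card_fin]
    _ ≤ ENNReal.ofReal (Real.exp (-(2 / Real.pi * (1 - θ ^ 2)))) ^ K := by
        rw [← ofReal_measureReal]
        gcongr
    _ = _ := by
        rw [← ENNReal.ofReal_pow (Real.exp_pos _).le, ← Real.exp_nat_mul]
        congr 2
        ring
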